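/- Let A be a countable or finite nonempty set and R a set of finitary relations on A. Then R = sInv Aut R if and only if R is a ∩-closed Krasner algebra, R = ⟨R⟩_{KA,∩}. Consequently, ⟨Q⟩_{KA,∩} = sInv Aut Q for every set Q of finitary relations on A. -/

import Mathlib

open FirstOrder

/-- A finitary relation on `A` of arity `m+1` (so all arities are ≥ 1). -/
def Rels (A : Type*) : Type _ := Σ m : ℕ, Set (Fin (m + 1) → A)

/-- The image `g[ρ]` of a relation under a permutation. -/
def permImage {A : Type*} (g : Equiv.Perm A) {m : ℕ} (ρ : Set (Fin m → A)) :
    Set (Fin m → A) := (fun a => ⇑g ∘ a) '' ρ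

/-- `Aut R`: permutations strongly preserving every relation in `R`. -/
def AutR {A : Type*} (R : Set (Rels A)) : Set (Equiv.Perm A) :=
  {g | ∀ ρ ∈ R, permImage g ρ.2 = ρ.2}

/-- `sInv G`: relations strongly invariant under every permutation in `G`. -/
def sInvG {A : Type*} (G : Set (Equiv.Perm A)) : Set (Rels A) :=
  {ρ | ∀ g ∈ G, permImage g ρ.2 = ρ.2}

/-- The language with relation symbols `P i` of arity `k i`, for `i : Fin n`. -/
def relLang (n : ℕ) (k : Fin n → ℕ) : Language where
  Functions := fun _ => Empty
  Relations := fun m => {i : Fin n // k i = m}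

/-- The structure on `A` interpreting `P i` as `ρ i`. -/
def relStruct {A : Type*} {n : ℕ} {k : Fin n → ℕ}
    (ρ : ∀ i : Fin n, Set (Fin (k i) → A)) : (relLang n k).Structure A where
  funMap := fun f _ => f.elim
  RelMap := fun {m} r x => (fun j => x (Fin.cast r.2 j)) ∈ ρ r.1

/-- The logical operation given by a first-order formula `φ` with `m` free
variables, applied to the relations `ρ i`. -/
def logicalOp {A : Type*} {n : ℕ} {k : Fin n → ℕ}
    (ρ : ∀ i : Fin n, Set (Fin (k i) → A)) {m : ℕ}
    (φ : (relLang n k).Formula (Fin m)) : Set (Fin m → A) :=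
  letI := relStruct ρ
  {a | φ.Realize a}

/-- `R` is closed under all logical operations (i.e. `R` is a Krasner algebra). -/
def KrasnerClosed {A : Type*} (R : Set (Rels A)) : Prop :=
  ∀ (n : ℕ) (k : Fin n → ℕ) (ρ : ∀ i : Fin n, Set (Fin (k i + 1) → A)),
    (∀ i, (⟨k i, ρ i⟩ : Rels A) ∈ R) →
    ∀ (m : ℕ) (φ : (relLang n (fun i => k i + 1)).Formula (Fin (m + 1))),
      (⟨m, logicalOp ρ φ⟩ : Rels A) ∈ R

/-- `R` is ∩-closed: it contains each `A^m` and is closed under arbitrary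
intersections of relations of equal arity. -/
def InterClosed {A : Type*} (R : Set (Rels A)) : Prop :=
  (∀ m : ℕ, (⟨m, Set.univ⟩ : Rels A) ∈ R) ∧
  ∀ (m : ℕ) (Q : Set (Set (Fin (m + 1) → A))),
    (∀ ρ ∈ Q, (⟨m, ρ⟩ : Rels A) ∈ R) → (⟨m, ⋂₀ Q⟩ : Rels A) ∈ R

/-- `⟨Q⟩_{KA,∩}`: the least ∩-closed Krasner algebra containing `Q`. -/
def KAInterClosure {A : Type*} (Q : Set (Rels A)) : Set (Rels A) :=
  ⋂₀ {R | Q ⊆ R ∧ KrasnerClosed R ∧ InterClosed R}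

theorem permImage_eq_iff {A : Type*} (g : Equiv.Perm A) {m : ℕ} (ρ : Set (Fin m → A)) :
    permImage g ρ = ρ ↔ ∀ a, a ∈ ρ ↔ ⇑g ∘ a ∈ ρ := by
  have key : ∀ a, ⇑g ∘ a ∈ permImage g ρ ↔ a ∈ ρ := by
    intro a
    constructor
    · rintro ⟨b, hb, h⟩
      have : b = a := funext fun j => g.injective (congrFun h j)
      exact this ▸ hb
    · intro h
      exact ⟨a, h, rfl⟩
  constructor
  · intro h a
    rw [← key a, h]
  · intro h
    ext x
    have hx : x = ⇑g ∘ (⇑g.symm ∘ x) := by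
      funext j; simp
    rw [hx, key, h]

theorem sInv_krasner {A : Type*} (G : Set (Equiv.Perm A)) : KrasnerClosed (sInvG G) := by
  intro n k ρ hρ m φ g hg
  rw [permImage_eq_iff]
  intro a
  letI := relStruct ρ
  let e : A ≃[relLang n (fun i => k i + 1)] A :=
    { g with
      map_fun' := fun f _ => f.elim
      map_rel' := by
        intro l r x
        obtain ⟨i, rfl⟩ := r
        exact ((permImage_eq_iff g (ρ i)).1 (hρ i g hg) x).symm }
  have h := FirstOrder.Language.StrongHomClass.realize_formula e φ (v := a)
  exact h.symm

theorem sInv_inter {A : Type*} (G : Set (Equiv.Perm A)) : InterClosed (sInvG G) := by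
  refine ⟨fun m g hg => ?_, fun m Q hQ g hg => ?_⟩
  · rw [permImage_eq_iff]; intro a; simp
  · rw [permImage_eq_iff]
    intro a
    simp only [Set.mem_sInter]
    exact forall₂_congr fun ρ h => (permImage_eq_iff g ρ).1 (hQ ρ h g hg) a

section closure
variable {A : Type*} {R : Set (Rels A)}

theorem kc_one (hK : KrasnerClosed R) {k : ℕ} {ρ : Set (Fin (k + 1) → A)}
    (h : (⟨k, ρ⟩ : Rels A) ∈ R) {m : ℕ}
    (φ : (relLang 1 (fun _ => k + 1)).Formula (Fin (m + 1))) :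
    (⟨m, logicalOp (fun _ : Fin 1 => ρ) φ⟩ : Rels A) ∈ R :=
  hK 1 (fun _ => k) (fun _ => ρ) (fun _ => h) m φ

theorem kc_subst (hK : KrasnerClosed R) {k : ℕ} {ρ : Set (Fin (k + 1) → A)}
    (h : (⟨k, ρ⟩ : Rels A) ∈ R) {m : ℕ} (f : Fin (k + 1) → Fin (m + 1)) :
    (⟨m, {x | x ∘ f ∈ ρ}⟩ : Rels A) ∈ R := by
  let r : (relLang 1 (fun _ => k + 1)).Relations (k + 1) := ⟨0, rfl⟩
  have := kc_one hK h (m := m) (r.formula (fun j => Language.Term.var (f j)))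
  convert this using 2
  letI := relStruct (fun _ : Fin 1 => ρ)
  ext x
  simp only [logicalOp, Set.mem_ofPred_eq]
  rw [Language.Formula.realize_rel]
  rfl

theorem kc_compl (hK : KrasnerClosed R) {k : ℕ} {ρ : Set (Fin (k + 1) → A)}
    (h : (⟨k, ρ⟩ : Rels A) ∈ R) : (⟨k, ρᶜ⟩ : Rels A) ∈ R := by
  let r : (relLang 1 (fun _ => k + 1)).Relations (k + 1) := ⟨0, rfl⟩
  have := kc_one hK h (m := k) (r.formula (fun j => Language.Term.var j)).not
  convert this using 2
  letI := relStruct (fun _ : Fin 1 => ρ)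
  ext x
  simp only [logicalOp, Set.mem_ofPred_eq]
  rw [Language.Formula.realize_not, Language.Formula.realize_rel]
  rfl

theorem kc_eq (hK : KrasnerClosed R) {m : ℕ} (i j : Fin (m + 1)) :
    (⟨m, {x | x i = x j}⟩ : Rels A) ∈ R := by
  have := hK 0 (fun _ => 0) (fun _ => ∅) (fun i => i.elim0) m
    (Language.Term.equal (Language.Term.var i) (Language.Term.var j))
  convert this using 2
  letI := relStruct (A := A) (n := 0) (k := fun _ => 0 + 1) (fun _ => ∅)
  ext x
  simp only [logicalOp, Set.mem_ofPred_eq]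
  rw [Language.Formula.realize_equal]
  rfl

theorem kc_ex (hK : KrasnerClosed R) {m : ℕ} {ρ : Set (Fin (m + 2) → A)}
    (h : (⟨m + 1, ρ⟩ : Rels A) ∈ R) :
    (⟨m, {x | ∃ y, (Fin.snoc x y : Fin (m + 2) → A) ∈ ρ}⟩ : Rels A) ∈ R := by
  let r : (relLang 1 (fun _ => m + 1 + 1)).Relations (m + 2) := ⟨0, rfl⟩
  let t : Fin (m + 2) → (relLang 1 (fun _ => m + 1 + 1)).Term (Fin (m + 1) ⊕ Fin 1) :=
    Fin.snoc (α := fun _ => (relLang 1 (fun _ => m + 1 + 1)).Term (Fin (m + 1) ⊕ Fin 1))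
      (fun j : Fin (m + 1) => Language.Term.var (Sum.inl j)) (Language.Term.var (Sum.inr 0))
  have := kc_one hK h (m := m) (r.boundedFormula t).ex
  convert this using 2
  letI := relStruct (fun _ : Fin 1 => ρ)
  ext x
  simp only [logicalOp, Set.mem_ofPred_eq]
  unfold Language.Formula.Realize
  rw [Language.BoundedFormula.realize_ex]
  refine exists_congr fun y => ?_
  rw [Language.BoundedFormula.realize_rel]
  refine Eq.to_iff (congrArg (· ∈ ρ) (funext fun j => ?_))
  refine Fin.lastCases ?_ (fun j => ?_) j
  · simp [t, Fin.snoc]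
  · simp [t]

/-- every relation of arity `N+1` in `R` containing the initial segment of `a` contains that of `b`. -/
def Sim (R : Set (Rels A)) (N : ℕ) (a b : ℕ → A) : Prop :=
  ∀ ρ : Set (Fin (N + 1) → A), (⟨N, ρ⟩ : Rels A) ∈ R →
    (fun i : Fin (N + 1) => a i) ∈ ρ → (fun i : Fin (N + 1) => b i) ∈ ρ

theorem Sim.symm (hK : KrasnerClosed R) {N : ℕ} {a b : ℕ → A} (h : Sim R N a b) :
    Sim R N b a := by
  intro ρ hρ hb
  by_contra ha
  exact h _ (kc_compl hK hρ) ha hb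

theorem snoc_restrict (N : ℕ) (a : ℕ → A) (c : A) :
    (fun i : Fin (N + 2) => Function.update a (N + 1) c i) =
      (Fin.snoc (fun i : Fin (N + 1) => a i) c : Fin (N + 2) → A) := by
  funext j
  refine Fin.lastCases ?_ (fun j => ?_) j
  · simp
  · have : (j : ℕ) ≠ N + 1 := by have := j.2; omega
    simp [this]

theorem Sim.extend (hK : KrasnerClosed R) (hI : InterClosed R) {N : ℕ} {a b : ℕ → A}
    (h : Sim R N a b) (c : A) :
    ∃ d, Sim R (N + 1) (Function.update a (N + 1) c) (Function.update b (N + 1) d) := by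
  let a' : Fin (N + 2) → A := Fin.snoc (fun i : Fin (N + 1) => a i) c
  have hΓ := hI.2 (N + 1) {ρ | (⟨N + 1, ρ⟩ : Rels A) ∈ R ∧ a' ∈ ρ} (fun ρ hρ => hρ.1)
  obtain ⟨d, hd⟩ := h _ (kc_ex hK hΓ) ⟨c, fun ρ hρ => hρ.2⟩
  refine ⟨d, fun ρ hρ ha => ?_⟩
  rw [snoc_restrict] at ha ⊢
  exact hd ρ ⟨hρ, ha⟩

theorem Sim.step (hK : KrasnerClosed R) (hI : InterClosed R) {N : ℕ} {a b : ℕ → A}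
    (h : Sim R N a b) (c : A) (side : Prop) :
    ∃ p : (ℕ → A) × (ℕ → A), Sim R (N + 1) p.1 p.2 ∧
      (∀ i ≤ N, p.1 i = a i ∧ p.2 i = b i) ∧
      (side → p.1 (N + 1) = c) ∧ (¬ side → p.2 (N + 1) = c) := by
  by_cases hs : side
  · obtain ⟨d, hd⟩ := h.extend hK hI c
    refine ⟨(Function.update a (N + 1) c, Function.update b (N + 1) d), hd, fun i hi => ?_, fun _ => by simp, fun h => absurd hs h⟩
    have : i ≠ N + 1 := by omega
    simp [this]
  · obtain ⟨d, hd⟩ := (h.symm hK).extend hK hI c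
    refine ⟨(Function.update a (N + 1) d, Function.update b (N + 1) c), hd.symm hK, fun i hi => ?_, fun h => absurd h hs, fun _ => by simp⟩
    have : i ≠ N + 1 := by omega
    simp [this]

theorem Sim.limit (hK : KrasnerClosed R) (hI : InterClosed R) [Nonempty A] [Countable A]
    {m : ℕ} {a b : ℕ → A} (h : Sim R m a b) :
    ∃ a' b' : ℕ → A, (∀ i ≤ m, a' i = a i ∧ b' i = b i) ∧ (∀ k, Sim R (m + k) a' b') ∧
      Function.Surjective a' ∧ Function.Surjective b' := by
  obtain ⟨e, he⟩ := exists_surjective_nat A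
  let S : ℕ → Type _ := fun k => {p : (ℕ → A) × (ℕ → A) // Sim R (m + k) p.1 p.2}
  have st : ∀ (k : ℕ) (p : S k), ∃ q : S (k + 1),
      (∀ i ≤ m + k, q.1.1 i = p.1.1 i ∧ q.1.2 i = p.1.2 i) ∧
      (Even k → q.1.1 (m + k + 1) = e (k / 2)) ∧ (¬ Even k → q.1.2 (m + k + 1) = e (k / 2)) := by
    intro k p
    obtain ⟨q, h1, h2⟩ := Sim.step hK hI p.2 (e (k / 2)) (Even k)
    exact ⟨⟨q, h1⟩, h2⟩
  choose F hF1 hF2 hF3 using st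
  let s : ∀ k, S k := fun k => Nat.rec (motive := S) ⟨(a, b), h⟩ F k
  have hs : ∀ k, s (k + 1) = F k (s k) := fun k => rfl
  have stab : ∀ k l i, i ≤ m + k →
      (s (k + l)).1.1 i = (s k).1.1 i ∧ (s (k + l)).1.2 i = (s k).1.2 i := by
    intro k l i hi
    induction l with
    | zero => exact ⟨rfl, rfl⟩
    | succ l ih =>
      have := hF1 (k + l) (s (k + l)) i (by omega)
      rw [← ih.1, ← ih.2]
      exact this
  have lim : ∀ k i, i ≤ m + k →
      (s i).1.1 i = (s k).1.1 i ∧ (s i).1.2 i = (s k).1.2 i := by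
    intro k i hi
    have h1 := stab k i i hi
    have h2 := stab i k i (by omega)
    rw [Nat.add_comm i k] at h2
    exact ⟨h2.1.symm.trans h1.1, h2.2.symm.trans h1.2⟩
  refine ⟨fun i => (s i).1.1 i, fun i => (s i).1.2 i, fun i hi => lim 0 i hi, ?_, ?_, ?_⟩
  · intro k ρ hρ ha
    have e1 : (fun i : Fin (m + k + 1) => (s i).1.1 i) = fun i : Fin (m + k + 1) => (s k).1.1 i :=
      funext fun i => (lim k i (by have := i.2; omega)).1
    have e2 : (fun i : Fin (m + k + 1) => (s i).1.2 i) = fun i : Fin (m + k + 1) => (s k).1.2 i :=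
      funext fun i => (lim k i (by have := i.2; omega)).2
    rw [e1] at ha
    rw [e2]
    exact (s k).2 ρ hρ ha
  · intro y
    obtain ⟨n, rfl⟩ := he y
    refine ⟨m + 2 * n + 1, ?_⟩
    have h1 := (lim (2 * n + 1) (m + 2 * n + 1) (by omega)).1
    have h2 := hF2 (2 * n) (s (2 * n)) (by simp)
    have h3 : 2 * n / 2 = n := by omega
    rw [h3] at h2
    exact h1.trans h2
  · intro y
    obtain ⟨n, rfl⟩ := he y
    refine ⟨m + (2 * n + 1) + 1, ?_⟩
    have h1 := (lim (2 * n + 1 + 1) (m + (2 * n + 1) + 1) (by omega)).2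
    have h2 := hF3 (2 * n + 1) (s (2 * n + 1)) (by simp)
    have h3 : (2 * n + 1) / 2 = n := by omega
    rw [h3] at h2
    exact h1.trans h2

theorem Sim.exists_aut (hK : KrasnerClosed R) (hI : InterClosed R) [Nonempty A] [Countable A]
    {m : ℕ} {a b : ℕ → A} (h : Sim R m a b) :
    ∃ g ∈ AutR R, ∀ i ≤ m, g (a i) = b i := by
  obtain ⟨a', b', hab, hsim, ha, hb⟩ := h.limit hK hI
  have one : ∀ (k : ℕ) (f : Fin (k + 1) → ℕ) (ρ : Set (Fin (k + 1) → A)),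
      (⟨k, ρ⟩ : Rels A) ∈ R → (a' ∘ f ∈ ρ ↔ b' ∘ f ∈ ρ) := by
    intro k f ρ hρ
    obtain ⟨M, hM⟩ : ∃ M, ∀ j, f j ≤ M := by
      obtain ⟨M, hM⟩ := (Set.finite_range f).bddAbove
      exact ⟨M, fun j => hM ⟨j, rfl⟩⟩
    let f' : Fin (k + 1) → Fin (m + M + 1) := fun j => ⟨f j, by have := hM j; omega⟩
    have h1 := kc_subst hK hρ f'
    exact ⟨hsim M _ h1, (hsim M).symm hK _ h1⟩
  have eq : ∀ i j, a' i = a' j ↔ b' i = b' j := by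
    intro i j
    exact one 1 ![i, j] _ (kc_eq hK 0 1)
  choose u hu using ha
  choose v hv using hb
  let g : Equiv.Perm A :=
    { toFun := fun x => b' (u x)
      invFun := fun y => a' (v y)
      left_inv := fun x => by
        have := (eq (v (b' (u x))) (u x)).2 (hv _)
        exact this.trans (hu x)
      right_inv := fun y => by
        have := (eq (u (a' (v y))) (v y)).1 (hu _)
        exact this.trans (hv y) }
  refine ⟨g, ?_, ?_⟩
  · rintro ⟨k, ρ⟩ hρ
    rw [permImage_eq_iff]
    intro x
    have := one k (u ∘ x) ρ hρ
    have hx : a' ∘ (u ∘ x) = x := funext fun j => hu (x j)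
    rw [hx] at this
    exact this
  · intro i hi
    rw [← (hab i hi).1, ← (hab i hi).2]
    exact (eq _ _).1 (hu _)

theorem sInv_aut_subset [Nonempty A] [Countable A] (hK : KrasnerClosed R) (hI : InterClosed R) :
    sInvG (AutR R) ⊆ R := by
  rintro ⟨m, σ⟩ hσ
  have key : ∀ x ∈ σ, ∀ y ∉ σ, ∃ ρ : Set (Fin (m + 1) → A),
      (⟨m, ρ⟩ : Rels A) ∈ R ∧ x ∈ ρ ∧ y ∉ ρ := by
    intro x hx y hy
    by_contra hcon
    push Not at hcon
    let ext : (Fin (m + 1) → A) → ℕ → A := fun z i =>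
      if h : i < m + 1 then z ⟨i, h⟩ else z 0
    have hext : ∀ z, (fun i : Fin (m + 1) => ext z i) = z := by
      intro z; funext i; exact dif_pos i.2
    have hsim : Sim R m (ext x) (ext y) := by
      intro ρ hρ h1
      rw [hext] at h1 ⊢
      exact hcon ρ hρ h1
    obtain ⟨g, hg, hgi⟩ := hsim.exists_aut hK hI
    have h2 := (permImage_eq_iff g σ).1 (hσ g hg) x
    have h3 : ⇑g ∘ x = y := by
      rw [← hext x, ← hext y]
      funext i
      exact hgi i (by have := i.2; omega)
    rw [h3] at h2
    exact hy (h2.1 hx)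
  -- for each y outside, the union of separating relations
  have sep : ∀ y ∉ σ, ∃ τ : Set (Fin (m + 1) → A), (⟨m, τ⟩ : Rels A) ∈ R ∧ σ ⊆ τ ∧ y ∉ τ := by
    intro y hy
    have h1 := hI.2 m {ρ | (⟨m, ρ⟩ : Rels A) ∈ R ∧ y ∈ ρ} (fun ρ h => h.1)
    refine ⟨_, kc_compl hK h1, ?_, ?_⟩
    · intro x hx hmem
      obtain ⟨ρ, hρ, hxρ, hyρ⟩ := key x hx y hy
      exact hmem ρᶜ ⟨kc_compl hK hρ, hyρ⟩ hxρ
    · intro hn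
      exact hn fun ρ h => h.2
  have h2 := hI.2 m {τ | (⟨m, τ⟩ : Rels A) ∈ R ∧ σ ⊆ τ} (fun ρ h => h.1)
  have h3 : ⋂₀ {τ | (⟨m, τ⟩ : Rels A) ∈ R ∧ σ ⊆ τ} = σ := by
    apply Set.Subset.antisymm
    · intro y hy
      by_contra hyσ
      obtain ⟨τ, h4, h5, h6⟩ := sep y hyσ
      exact h6 (hy τ ⟨h4, h5⟩)
    · intro x hx τ hτ
      exact hτ.2 hx
  rw [h3] at h2
  exact h2

end closure

/-- Let `A` be a countable (or finite) nonempty set.  Then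
`R = sInv Aut R` iff `R` is a ∩-closed Krasner algebra, `R = ⟨R⟩_{KA,∩}`.
Consequently, `⟨Q⟩_{KA,∩} = sInv Aut Q` for every `Q`. -/
theorem stmt7 {A : Type*} [Nonempty A] [Countable A] :
    (∀ R : Set (Rels A), R = sInvG (AutR R) ↔ R = KAInterClosure R) ∧
    (∀ Q : Set (Rels A), KAInterClosure Q = sInvG (AutR Q)) := by
  have main : ∀ Q : Set (Rels A), KAInterClosure Q = sInvG (AutR Q) := by
    intro Q
    apply Set.Subset.antisymm
    · exact Set.sInter_subset_of_mem
        ⟨fun ρ hρ g hg => hg ρ hρ, sInv_krasner _, sInv_inter _⟩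
    · rintro ρ hρ R ⟨hQR, hK, hI⟩
      exact sInv_aut_subset hK hI (fun g hg => hρ g fun τ hτ => hg τ (hQR hτ))
  exact ⟨fun R => by rw [main R], main⟩
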